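/- For any m-by-n complex matrix F whose columns are unit vectors (n ≥ m ≥ 1), the trace of (FF')^d is at least m·(n/m)^d for every natural number d ≥ 1, i.e. (1/n)·tr((FF')^d) ≥ (n/m)^(d-1). -/

import Mathlib

open Matrix BigOperators
open scoped ComplexOrder

theorem erasure_welch_stmt0 (m n : ℕ) (hm : 1 ≤ m) (hmn : m ≤ n)
    (F : Matrix (Fin m) (Fin n) ℂ)
    (hcol : ∀ i, (Fᴴ * F) i i = 1)
    (d : ℕ) (hd : 1 ≤ d) :
    ((n : ℝ) / m) ^ (d - 1) ≤ (1 / (n : ℝ)) * (Matrix.trace ((F * Fᴴ) ^ d)).re := by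
  have hps : (F * Fᴴ).PosSemidef := Matrix.posSemidef_self_mul_conjTranspose F
  have hA := hps.isHermitian
  have htr : ∀ k : ℕ, Matrix.trace ((F * Fᴴ) ^ k) = ((∑ i, hA.eigenvalues i ^ k : ℝ) : ℂ) := by
    intro k
    have h := hA.spectral_theorem
    have h2 : (F * Fᴴ) ^ k = Unitary.conjStarAlgAut ℂ _ hA.eigenvectorUnitary
        ((diagonal (RCLike.ofReal ∘ hA.eigenvalues)) ^ k) := by
      rw [map_pow, ← h]
    rw [h2, Unitary.conjStarAlgAut_apply, Matrix.trace_mul_comm, ← mul_assoc,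
      Unitary.coe_star_mul_self, one_mul, Matrix.diagonal_pow, Matrix.trace_diagonal]
    simp
  have hsum : ∑ i, hA.eigenvalues i = n := by
    have h1 := htr 1
    rw [pow_one, Matrix.trace_mul_comm] at h1
    simp only [Matrix.trace, Matrix.diag, hcol, pow_one] at h1
    simp at h1
    exact_mod_cast h1.symm
  obtain ⟨k, rfl⟩ : ∃ k, d = k + 1 := ⟨d - 1, by omega⟩
  have hp := pow_sum_div_card_le_sum_pow (s := Finset.univ) (f := hA.eigenvalues)
    (fun i _ => hps.eigenvalues_nonneg i) k
  rw [htr, Complex.ofReal_re, Nat.add_sub_cancel]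
  have hn : (0 : ℝ) < n := by exact_mod_cast (by omega : 0 < n)
  have hm' : (0 : ℝ) < m := by exact_mod_cast hm
  rw [hsum] at hp
  simp only [Finset.card_univ, Fintype.card_fin] at hp
  calc ((n : ℝ) / m) ^ k = 1 / n * ((n : ℝ) ^ (k + 1) / (m : ℝ) ^ k) := by
        rw [div_pow, pow_succ]
        field_simp
    _ ≤ _ := by gcongr
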